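/- Let M, K, φ, T_m, N, K', ψ, T_n, m, n, T_p be natural numbers with K ≤ M, 1 ≤ φ ≤ M, 1 ≤ T_m ≤ φ, K' ≤ N, 1 ≤ ψ ≤ N, 1 ≤ T_n ≤ ψ, m, n ≥ 1 and T_p ≥ 1. Define s = K/M − (T_m−1)/φ and t = K'/N − (T_n−1)/ψ, and assume s ≥ 0 and t ≥ 0. Define P(ω_k) = ∏_{i=1}^m ∏_{j=1}^n [(∑_{α=0}^{T_m−1} C(K,α)·C(M−K, φ−α)/C(M,φ)) · (∑_{β=0}^{T_n−1} C(K',β)·C(N−K', ψ−β)/C(N,ψ))]. Then the detection probability after T_p independent repartitionings satisfies 1 − P(ω_k)^{T_p} ≥ 1 − exp(−2·T_p·(φ·m·s² + ψ·n·t²)). -/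

import Mathlib

/-- **Hoeffding's lemma** for a Bernoulli variable of parameter `q`. -/
theorem bernoulli_mgf_le_exp {q : ℝ} (hq0 : 0 ≤ q) (hq1 : q ≤ 1) (l : ℝ) :
    1 - q + q * Real.exp l ≤ Real.exp (l * q + l ^ 2 / 8) := by
  let μ : MeasureTheory.Measure ℝ :=
    ENNReal.ofReal (1 - q) • MeasureTheory.Measure.dirac 0 +
      ENNReal.ofReal q • MeasureTheory.Measure.dirac 1
  have hμ : MeasureTheory.IsProbabilityMeasure μ := by
    constructor
    simp [μ, ← ENNReal.ofReal_add (sub_nonneg.2 hq1) hq0]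
  have hint (f : ℝ → ℝ) : ∫ x, f x ∂μ = (1 - q) * f 0 + q * f 1 := by
    have hdirac (a : ℝ) : MeasureTheory.Integrable f (MeasureTheory.Measure.dirac a) :=
      MeasureTheory.integrable_dirac (by simp)
    rw [MeasureTheory.integral_add_measure ((hdirac 0).smul_measure ENNReal.ofReal_ne_top)
      ((hdirac 1).smul_measure ENNReal.ofReal_ne_top)]
    simp [MeasureTheory.integral_smul_measure, hq0, hq1]
  have hmem : ∀ᵐ x ∂μ, id x ∈ Set.Icc (0 : ℝ) 1 := by
    simp only [μ, MeasureTheory.ae_add_measure_iff]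
    constructor <;> apply MeasureTheory.Measure.ae_smul_measure <;> simp [MeasureTheory.ae_dirac_eq]
  have h := (ProbabilityTheory.hasSubgaussianMGF_of_mem_Icc aemeasurable_id hmem).mgf_le l
  simp only [ProbabilityTheory.mgf, hint] at h
  have key := mul_le_mul_of_nonneg_left h (Real.exp_pos (l * q)).le
  rw [← Real.exp_add] at key
  have h0 : Real.exp (l * q) * Real.exp (l * (0 - q)) = 1 := by
    rw [← Real.exp_add, ← Real.exp_zero]; ring_nf
  have h1 : Real.exp (l * q) * Real.exp (l * (1 - q)) = Real.exp l := by
    rw [← Real.exp_add]; ring_nf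
  norm_num at key
  norm_num at h0
  calc 1 - q + q * Real.exp l
      = Real.exp (l * q) * ((1 - q) * Real.exp (-(l * q)) + q * Real.exp (l * (1 - q))) := by
        rw [← h1]; linear_combination (-(1 - q)) * h0
    _ ≤ _ := key
    _ = _ := by ring_nf

theorem pow_mul_choose_le_pow_mul_choose {L M : ℕ} (h : L ≤ M) (j : ℕ) :
    M ^ j * L.choose j ≤ L ^ j * M.choose j := by
  induction j with
  | zero => simp
  | succ j ih =>
    have hsub : M * (L - j) ≤ L * (M - j) := by
      rw [Nat.mul_sub, Nat.mul_sub, mul_comm M L]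
      exact Nat.sub_le_sub_left (Nat.mul_le_mul_right j h) _
    refine Nat.le_of_mul_le_mul_right ?_ (Nat.succ_pos j)
    calc M ^ (j + 1) * L.choose (j + 1) * (j + 1)
        = M ^ j * L.choose j * (M * (L - j)) := by
          rw [mul_assoc, Nat.choose_succ_right_eq]; ring
      _ ≤ L ^ j * M.choose j * (L * (M - j)) := Nat.mul_le_mul ih hsub
      _ = L ^ (j + 1) * M.choose (j + 1) * (j + 1) := by
          rw [mul_assoc (L ^ (j + 1)), Nat.choose_succ_right_eq]; ring

/-- Factorial moments of the hypergeometric distribution. -/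
theorem sum_choose_mul_choose_mul_choose (K L r j : ℕ) :
    ∑ b ∈ Finset.range (j + r + 1), K.choose (j + r - b) * L.choose b * b.choose j =
      L.choose j * (K + L - j).choose r := by
  rcases lt_or_ge L j with hj | hj
  · rw [Nat.choose_eq_zero_of_lt hj, zero_mul]
    refine Finset.sum_eq_zero fun b _ => ?_
    rcases lt_or_ge b j with hb | hb
    · rw [Nat.choose_eq_zero_of_lt hb, mul_zero]
    · rw [Nat.choose_eq_zero_of_lt (hj.trans_le hb), mul_zero, zero_mul]
  · rw [add_assoc, Finset.sum_range_add, Finset.sum_eq_zero, zero_add, Nat.add_sub_assoc hj,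
      add_comm K, Nat.add_choose_eq, Finset.Nat.sum_antidiagonal_eq_sum_range_succ_mk,
      Finset.mul_sum]
    · refine Finset.sum_congr rfl fun b _ => ?_
      have h := Nat.choose_mul (n := L) (Nat.le_add_right j b)
      rw [Nat.add_sub_cancel_left] at h
      rw [Nat.add_sub_add_left, mul_assoc, h]
      ring
    · intro b hb
      rw [Nat.choose_eq_zero_of_lt (Finset.mem_range.1 hb), mul_zero]

/-- The hypergeometric generating function is dominated by the binomial one to the right of `1`. -/
theorem sum_choose_mul_choose_mul_pow_le {K L f : ℕ} (hKL : 0 < K + L) {x : ℝ} (hx : 0 ≤ x) :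
    ∑ b ∈ Finset.range (f + 1), (K.choose (f - b) : ℝ) * L.choose b * (x + 1) ^ b ≤
      (K + L).choose f * (L / (K + L : ℕ) * x + 1) ^ f := by
  have hM : (0 : ℝ) < (K + L : ℕ) := by exact_mod_cast hKL
  have hexpand : ∀ b ∈ Finset.range (f + 1), (x + 1) ^ b =
      ∑ j ∈ Finset.range (f + 1), x ^ j * (b.choose j : ℝ) := by
    intro b hb
    rw [add_pow]
    simp only [one_pow, mul_one]
    refine Finset.sum_subset (Finset.range_mono (by simpa using hb)) fun j _ hj => ?_
    rw [Nat.choose_eq_zero_of_lt (by simpa using hj)]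
    simp
  rw [add_pow, Finset.mul_sum,
    Finset.sum_congr rfl fun b hb => by rw [hexpand b hb, Finset.mul_sum], Finset.sum_comm]
  refine Finset.sum_le_sum fun j hj => ?_
  obtain ⟨r, rfl⟩ := Nat.exists_eq_add_of_le (Nat.lt_succ_iff.1 (Finset.mem_range.1 hj))
  have hmoment := sum_choose_mul_choose_mul_choose K L r j
  have hmul := Nat.choose_mul (n := K + L) (Nat.le_add_right j r)
  rw [Nat.add_sub_cancel_left] at hmul
  have hratio : (L.choose j : ℝ) ≤ (L / (K + L : ℕ)) ^ j * (K + L).choose j := by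
    rw [div_pow, div_mul_eq_mul_div, le_div_iff₀ (pow_pos hM j), mul_comm]
    exact_mod_cast pow_mul_choose_le_pow_mul_choose (Nat.le_add_left L K) j
  calc ∑ b ∈ Finset.range (j + r + 1),
        (K.choose (j + r - b) : ℝ) * L.choose b * (x ^ j * b.choose j)
      = x ^ j * ((L.choose j : ℝ) * (K + L - j).choose r) := by
        rw [← Nat.cast_mul, ← hmoment, Nat.cast_sum, Finset.mul_sum]
        refine Finset.sum_congr rfl fun b _ => ?_
        push_cast
        ring
    _ ≤ x ^ j * (((L / (K + L : ℕ)) ^ j * (K + L).choose j) * (K + L - j).choose r) := by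
        gcongr
    _ = _ := by
        have hmul' : ((K + L).choose (j + r) : ℝ) * (j + r).choose j =
            (K + L).choose j * (K + L - j).choose r := by exact_mod_cast hmul
        rw [one_pow, mul_one, mul_pow]
        linear_combination (-(x ^ j * (L / (K + L : ℕ) : ℝ) ^ j)) * hmul'

/-- **Hoeffding's inequality** for the lower tail of the hypergeometric distribution. -/
theorem hypergeometric_lower_tail_le {M K f T : ℕ} (hKM : K ≤ M) (hf : 1 ≤ f) (hfM : f ≤ M)
    (hTf : T ≤ f) {s : ℝ} (hs : s = (K : ℝ) / M - ((T : ℝ) - 1) / f) (hs0 : 0 ≤ s) :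
    ∑ a ∈ Finset.range T, ((K.choose a : ℝ) * ((M - K).choose (f - a) : ℝ)) / (M.choose f : ℝ) ≤
      Real.exp (-2 * (f * s ^ 2)) := by
  obtain ⟨L, rfl⟩ := Nat.exists_eq_add_of_le hKM
  have hC : (0 : ℝ) < (K + L).choose f := by exact_mod_cast Nat.choose_pos hfM
  have hM : (0 : ℝ) < (K + L : ℕ) := by exact_mod_cast (by lia : 0 < K + L)
  have hf0 : (0 : ℝ) < f := by exact_mod_cast hf
  have hexp : 1 ≤ Real.exp (4 * s) := Real.one_le_exp (by positivity)
  have hgen := sum_choose_mul_choose_mul_pow_le (K := K) (L := L) (f := f) (by lia)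
    (sub_nonneg.2 hexp)
  have hq1 : (L : ℝ) / (K + L : ℕ) ≤ 1 := by
    rw [div_le_one hM]
    exact_mod_cast Nat.le_add_left L K
  have hmgf := bernoulli_mgf_le_exp (by positivity) hq1 (4 * s)
  have hq0 : 0 ≤ (L : ℝ) / (K + L : ℕ) := by positivity
  have hdev : (f : ℝ) - T + 1 - f * (L / (K + L : ℕ)) = f * s := by
    rw [hs]
    field_simp
    push_cast
    ring
  rw [Nat.add_sub_cancel_left, ← Finset.sum_div, div_le_iff₀ hC]
  refine le_of_mul_le_mul_right ?_ (pow_pos (Real.exp_pos (4 * s)) (f + 1 - T))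
  calc (∑ a ∈ Finset.range T, (K.choose a : ℝ) * L.choose (f - a)) *
        Real.exp (4 * s) ^ (f + 1 - T)
      ≤ ∑ a ∈ Finset.range T,
          (K.choose a : ℝ) * L.choose (f - a) * Real.exp (4 * s) ^ (f - a) := by
        rw [Finset.sum_mul]
        refine Finset.sum_le_sum fun a ha => ?_
        have := Finset.mem_range.1 ha
        exact mul_le_mul_of_nonneg_left (pow_le_pow_right₀ hexp (by lia)) (by positivity)
    _ ≤ ∑ a ∈ Finset.range (f + 1),
          (K.choose a : ℝ) * L.choose (f - a) * Real.exp (4 * s) ^ (f - a) :=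
        Finset.sum_le_sum_of_subset_of_nonneg (Finset.range_mono (by lia))
          fun _ _ _ => by positivity
    _ = ∑ b ∈ Finset.range (f + 1),
          (K.choose (f - b) : ℝ) * L.choose b * (Real.exp (4 * s) - 1 + 1) ^ b := by
        rw [← Finset.sum_range_reflect]
        refine Finset.sum_congr rfl fun b hb => ?_
        have := Finset.mem_range.1 hb
        rw [sub_add_cancel, show f + 1 - 1 - b = f - b by lia, show f - (f - b) = b by lia]
    _ ≤ _ := hgen
    _ ≤ (K + L).choose f *
          Real.exp (4 * s * (L / (K + L : ℕ)) + (4 * s) ^ 2 / 8) ^ f := by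
        have hbase : 0 ≤ (L : ℝ) / (K + L : ℕ) * (Real.exp (4 * s) - 1) + 1 :=
          add_nonneg (mul_nonneg hq0 (sub_nonneg.2 hexp)) zero_le_one
        refine mul_le_mul_of_nonneg_left (pow_le_pow_left₀ hbase ?_ f) hC.le
        linarith
    _ = _ := by
        rw [mul_comm (Real.exp _) ((K + L).choose f : ℝ), mul_assoc ((K + L).choose f : ℝ),
          ← Real.exp_nat_mul, ← Real.exp_nat_mul, ← Real.exp_add, Nat.cast_sub (by lia)]
        congr 2
        push_cast at hdev ⊢
        linear_combination (-4 * s) * hdev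

theorem detection_prob_after_repartitioning
    (M K φ Tm N K' ψ Tn m n Tp : ℕ)
    (hKM : K ≤ M) (hφ1 : 1 ≤ φ) (hφM : φ ≤ M) (hTm1 : 1 ≤ Tm) (hTmφ : Tm ≤ φ)
    (hK'N : K' ≤ N) (hψ1 : 1 ≤ ψ) (hψN : ψ ≤ N) (hTn1 : 1 ≤ Tn) (hTnψ : Tn ≤ ψ)
    (hm : 1 ≤ m) (hn : 1 ≤ n) (hTp : 1 ≤ Tp)
    (s t : ℝ)
    (hs : s = (K : ℝ) / M - ((Tm : ℝ) - 1) / φ)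
    (ht : t = (K' : ℝ) / N - ((Tn : ℝ) - 1) / ψ)
    (hs0 : 0 ≤ s) (ht0 : 0 ≤ t)
    (Pωk : ℝ)
    (hP : Pωk = ∏ _i ∈ Finset.range m, ∏ _j ∈ Finset.range n,
        ((∑ α ∈ Finset.range Tm,
            ((K.choose α : ℝ) * ((M - K).choose (φ - α) : ℝ)) / (M.choose φ : ℝ)) *
         (∑ β ∈ Finset.range Tn,
            ((K'.choose β : ℝ) * ((N - K').choose (ψ - β) : ℝ)) / (N.choose ψ : ℝ)))) :
    1 - Pωk ^ Tp ≥
      1 - Real.exp (-2 * (Tp : ℝ) * ((φ : ℝ) * m * s ^ 2 + (ψ : ℝ) * n * t ^ 2)) := by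
  have hrow := hypergeometric_lower_tail_le hKM hφ1 hφM hTmφ hs hs0
  have hcol := hypergeometric_lower_tail_le hK'N hψ1 hψN hTnψ ht ht0
  simp only [Finset.prod_const, Finset.card_range] at hP
  have hm' : (1 : ℝ) ≤ m := by exact_mod_cast hm
  have hn' : (1 : ℝ) ≤ n := by exact_mod_cast hn
  refine sub_le_sub_left ?_ 1
  calc Pωk ^ Tp
      ≤ (((Real.exp (-2 * (φ * s ^ 2)) * Real.exp (-2 * (ψ * t ^ 2))) ^ n) ^ m) ^ Tp := by
        rw [hP]
        gcongr
    _ = Real.exp (Tp * (m * (n * (-2 * (φ * s ^ 2) + -2 * (ψ * t ^ 2))))) := by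
        rw [← Real.exp_add, ← Real.exp_nat_mul, ← Real.exp_nat_mul, ← Real.exp_nat_mul]
    _ ≤ _ := by
        refine Real.exp_le_exp.2 ?_
        have hφs : 0 ≤ (Tp : ℝ) * m * (φ * s ^ 2) * (n - 1) :=
          mul_nonneg (by positivity) (sub_nonneg.2 hn')
        have hψt : 0 ≤ (Tp : ℝ) * n * (ψ * t ^ 2) * (m - 1) :=
          mul_nonneg (by positivity) (sub_nonneg.2 hm')
        linarith
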